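/- arXiv:1212.6830 — 2 statements merged into one kernel-verified Lean document; each statement's English description precedes it below -/
import Mathlib

section
/- Let n ≥ 2 be an integer, a ∈ (−1,1), b ∈ ℝ and ε > 0. Let B = {(t,y) : (t−b)² + y² < ε², y > 0} and Γ⁰ = {(t,0) : |t−b| < ε}, and let d : (b−ε, b+ε) → ℝ be continuous. Suppose u is continuous on the closure of B, twice continuously differentiable on B, satisfies u ≥ 0 on B, H_a u = 0 in B, and for every t with |t−b| < ε the limit lim_{y→0⁺} y^a ∂_y u(t,y) exists and −lim_{y→0⁺} y^a ∂_y u(t,y) + d(t) u(t,0) = 0. Then either u is identically 0 on B, or u > 0 on B ∪ Γ⁰. -/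
open Real Filter MeasureTheory Set Topology

noncomputable def pt (u : ℝ → ℝ → ℝ) (t y : ℝ) : ℝ := deriv (fun s => u s y) t
noncomputable def py (u : ℝ → ℝ → ℝ) (t y : ℝ) : ℝ := deriv (fun z => u t z) y
noncomputable def ptt (u : ℝ → ℝ → ℝ) (t y : ℝ) : ℝ := deriv (fun s => pt u s y) t
noncomputable def pyy (u : ℝ → ℝ → ℝ) (t y : ℝ) : ℝ := deriv (fun z => py u t z) y
noncomputable def pty (u : ℝ → ℝ → ℝ) (t y : ℝ) : ℝ := deriv (fun z => pt u t z) y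

/-- The degenerate elliptic operator `H_a u = u_yy + (a/y) u_y + u_tt + (n-1) tanh t · u_t`. -/
noncomputable def Ha (n : ℕ) (a : ℝ) (u : ℝ → ℝ → ℝ) (t y : ℝ) : ℝ :=
  pyy u t y + (a / y) * py u t y + ptt u t y + ((n : ℝ) - 1) * Real.tanh t * pt u t y


/-- Second-order necessary condition at a local minimum. -/
lemma IsLocalMin.deriv_deriv_nonneg {f : ℝ → ℝ} {x : ℝ} (h : IsLocalMin f x)
    (hf : ContinuousAt f x) : 0 ≤ deriv (deriv f) x := by
  by_contra! hneg
  have hmax : IsLocalMax f x := isLocalMax_of_deriv_deriv_neg hneg h.deriv_eq_zero hf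
  have hc : f =ᶠ[𝓝 x] fun _ => f x := by
    filter_upwards [h, hmax] with z h1 h2 using le_antisymm h2 h1
  have h2 := hc.deriv.deriv_eq
  simp at h2
  linarith

/-- At a local minimum of `f - g` the first derivatives agree and the second ones are ordered. -/
lemma deriv_eq_and_deriv_deriv_le_of_isLocalMin_sub {f g : ℝ → ℝ} {x : ℝ}
    (hf : ContDiffAt ℝ 2 f x) (hg : ContDiffAt ℝ 2 g x)
    (h : IsLocalMin (fun z => f z - g z) x) :
    deriv f x = deriv g x ∧ deriv (deriv g) x ≤ deriv (deriv f) x := by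
  have dd : ∀ {k : ℝ → ℝ}, ContDiffAt ℝ 2 k x →
      (∀ᶠ z in 𝓝 x, DifferentiableAt ℝ k z) ∧ DifferentiableAt ℝ (deriv k) x := by
    intro k hk
    refine ⟨?_, ?_⟩
    · filter_upwards [hk.eventually (by simp)] with z hz
      exact hz.differentiableAt (by norm_num)
    · exact (hk.derivWithin (m := 1) (by norm_num)).differentiableAt (by norm_num)
  have hd : deriv (fun z => f z - g z) =ᶠ[𝓝 x] fun z => deriv f z - deriv g z := by
    filter_upwards [(dd hf).1, (dd hg).1] with z h1 h2 using deriv_fun_sub h1 h2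
  have h1 := h.deriv_eq_zero
  rw [hd.eq_of_nhds] at h1
  have h2 := h.deriv_deriv_nonneg (hf.continuousAt.sub hg.continuousAt)
  rw [hd.deriv_eq, deriv_fun_sub (dd hf).2 (dd hg).2] at h2
  exact ⟨by linarith, by linarith⟩

/-- Comparison principle for `Ha` on a compact set. -/
lemma le_of_Ha_lt {n : ℕ} {a : ℝ} {u w : ℝ → ℝ → ℝ} {K : Set (ℝ × ℝ)} (hK : IsCompact K)
    (hu : ContinuousOn (fun p : ℝ × ℝ => u p.1 p.2) K)
    (hw : ContinuousOn (fun p : ℝ × ℝ => w p.1 p.2) K)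
    (h : ∀ p ∈ K, w p.1 p.2 ≤ u p.1 p.2 ∨ (K ∈ 𝓝 p ∧
      ContDiffAt ℝ 2 (fun p : ℝ × ℝ => u p.1 p.2) p ∧
      ContDiffAt ℝ 2 (fun p : ℝ × ℝ => w p.1 p.2) p ∧ Ha n a u p.1 p.2 < Ha n a w p.1 p.2)) :
    ∀ p ∈ K, w p.1 p.2 ≤ u p.1 p.2 := by
  intro p hp
  obtain ⟨⟨t, y⟩, hqK, hq⟩ := hK.exists_isMinOn ⟨p, hp⟩ (hu.sub hw)
  have hpq : u t y - w t y ≤ u p.1 p.2 - w p.1 p.2 := hq hp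
  rcases h _ hqK with h | ⟨hn, hcu, hcw, hlt⟩
  · simp only at h
    linarith
  exfalso
  have hmin : IsLocalMin (fun p : ℝ × ℝ => u p.1 p.2 - w p.1 p.2) (t, y) := hq.isLocalMin hn
  have ht : ContDiffAt ℝ 2 (fun s : ℝ => (s, y)) t := by fun_prop
  have hy : ContDiffAt ℝ 2 (fun z : ℝ => (t, z)) y := by fun_prop
  obtain ⟨t1, t2⟩ := deriv_eq_and_deriv_deriv_le_of_isLocalMin_sub
    (f := fun s => u s y) (g := fun s => w s y) (x := t)
    (ContDiffAt.comp (g := fun p : ℝ × ℝ => u p.1 p.2) t hcu ht)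
    (ContDiffAt.comp (g := fun p : ℝ × ℝ => w p.1 p.2) t hcw ht)
    (hmin.comp_continuous (g := fun s : ℝ => (s, y)) (b := t) ht.continuousAt)
  obtain ⟨y1, y2⟩ := deriv_eq_and_deriv_deriv_le_of_isLocalMin_sub
    (f := fun z => u t z) (g := fun z => w t z) (x := y)
    (ContDiffAt.comp (g := fun p : ℝ × ℝ => u p.1 p.2) y hcu hy)
    (ContDiffAt.comp (g := fun p : ℝ × ℝ => w p.1 p.2) y hcw hy)
    (hmin.comp_continuous (g := fun z : ℝ => (t, z)) (b := y) hy.continuousAt)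
  simp only [Ha, ptt, pyy] at hlt
  have e1 : pt u t y = pt w t y := t1
  have e2 : py u t y = py w t y := y1
  rw [e1, e2] at hlt
  have e3 : deriv (fun s => pt w s y) t ≤ deriv (fun s => pt u s y) t := t2
  have e4 : deriv (fun z => py w t z) y ≤ deriv (fun z => py u t z) y := y2
  linarith

lemma Ha_gaussian (n : ℕ) (a δ α c t₁ y₁ t y : ℝ) :
    Ha n a (fun t y => δ * (exp (-α * ((t - t₁) ^ 2 + (y - y₁) ^ 2)) - c)) t y =
      δ * exp (-α * ((t - t₁) ^ 2 + (y - y₁) ^ 2)) * (α * (4 * α * ((t - t₁) ^ 2 + (y - y₁) ^ 2)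
        - (4 + 2 * (a / y * (y - y₁)) + 2 * (((n : ℝ) - 1) * (tanh t * (t - t₁)))))) := by
  have h1 : ∀ (A x₁ : ℝ) (x : ℝ), HasDerivAt
      (fun x => δ * (exp (-α * ((x - x₁) ^ 2 + A)) - c))
      (δ * exp (-α * ((x - x₁) ^ 2 + A)) * (-α * (2 * (x - x₁)))) x := by
    intro A x₁ x
    have h := (((((hasDerivAt_id x).sub_const x₁).pow 2).add_const A).const_mul (-α)).exp
    refine ((h.sub_const c).const_mul δ).congr_deriv ?_
    simp
    ring
  have h2 : ∀ (A x₁ : ℝ) (x : ℝ), HasDerivAt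
      (fun x => δ * exp (-α * ((x - x₁) ^ 2 + A)) * (-α * (2 * (x - x₁))))
      (δ * exp (-α * ((x - x₁) ^ 2 + A)) * (4 * α ^ 2 * (x - x₁) ^ 2 - 2 * α)) x := by
    intro A x₁ x
    have h := (((((hasDerivAt_id x).sub_const x₁).pow 2).add_const A).const_mul (-α)).exp
    have h' := (((hasDerivAt_id x).sub_const x₁).const_mul 2).const_mul (-α)
    refine ((h.const_mul δ).mul h').congr_deriv ?_
    simp
    ring
  simp only [Ha, ptt, pyy, pt, py]
  have e1 : ∀ s z, deriv (fun s => δ * (exp (-α * ((s - t₁) ^ 2 + (z - y₁) ^ 2)) - c)) s =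
      δ * exp (-α * ((s - t₁) ^ 2 + (z - y₁) ^ 2)) * (-α * (2 * (s - t₁))) :=
    fun s z => (h1 _ _ s).deriv
  have e2 : ∀ s z, deriv (fun z => δ * (exp (-α * ((s - t₁) ^ 2 + (z - y₁) ^ 2)) - c)) z =
      δ * exp (-α * ((s - t₁) ^ 2 + (z - y₁) ^ 2)) * (-α * (2 * (z - y₁))) := by
    intro s z
    simp only [add_comm ((s - t₁) ^ 2)]
    exact (h1 _ _ z).deriv
  have e3 := (h2 ((y - y₁) ^ 2) t₁ t).deriv
  have e4 : deriv (fun z => δ * exp (-α * ((t - t₁) ^ 2 + (z - y₁) ^ 2)) *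
      (-α * (2 * (z - y₁)))) y =
      δ * exp (-α * ((t - t₁) ^ 2 + (y - y₁) ^ 2)) * (4 * α ^ 2 * (y - y₁) ^ 2 - 2 * α) := by
    simp only [add_comm ((t - t₁) ^ 2)]
    exact (h2 _ _ y).deriv
  simp only [e1, e2, e3, e4]
  ring

lemma Ha_rpow (n : ℕ) (a δ M K t₀ t : ℝ) {y : ℝ} (hy : 0 < y) :
    Ha n a (fun t y => δ * (y ^ (1 - a) * (1 - M * (t - t₀) ^ 2) + K * y ^ (3 - a))) t y =
      δ * y ^ (1 - a) * (2 * K * (3 - a) - 2 * M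
        - 2 * M * (((n : ℝ) - 1) * (tanh t * (t - t₀)))) := by
  have r : ∀ p : ℝ, ∀ z : ℝ, 0 < z → HasDerivAt (fun z : ℝ => z ^ p) (p * z ^ (p - 1)) z :=
    fun p z hz => Real.hasDerivAt_rpow_const (Or.inl hz.ne')
  have e1 : ∀ s z, deriv (fun s => δ * (z ^ (1 - a) * (1 - M * (s - t₀) ^ 2) +
      K * z ^ (3 - a))) s = δ * (z ^ (1 - a) * (-(M * (2 * (s - t₀))))) := by
    intro s z
    have h := ((((((hasDerivAt_id s).sub_const t₀).pow 2).const_mul M).const_sub 1).const_mul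
      (z ^ (1 - a))).add_const (K * z ^ (3 - a))
    refine (h.const_mul δ).deriv.trans ?_
    simp
  have e3 : deriv (fun s => δ * (y ^ (1 - a) * (-(M * (2 * (s - t₀)))))) t =
      δ * (y ^ (1 - a) * (-(M * 2))) := by
    have h := (((((hasDerivAt_id t).sub_const t₀).const_mul 2).const_mul M).neg.const_mul
      (y ^ (1 - a)))
    refine (h.const_mul δ).deriv.trans ?_
    simp
  have e2 : ∀ s, ∀ z : ℝ, 0 < z → deriv (fun z : ℝ => δ * (z ^ (1 - a) * (1 - M * (s - t₀) ^ 2) +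
      K * z ^ (3 - a))) z = δ * ((1 - a) * z ^ (1 - a - 1) * (1 - M * (s - t₀) ^ 2) +
      K * ((3 - a) * z ^ (3 - a - 1))) := by
    intro s z hz
    exact (((((r (1 - a) z hz).mul_const _).add ((r (3 - a) z hz).const_mul K)).const_mul δ)).deriv
  have e4 : deriv (fun z => deriv (fun z : ℝ => δ * (z ^ (1 - a) * (1 - M * (t - t₀) ^ 2) +
      K * z ^ (3 - a))) z) y = δ * ((1 - a) * ((1 - a - 1) * y ^ (1 - a - 1 - 1)) *
        (1 - M * (t - t₀) ^ 2) + K * ((3 - a) * ((3 - a - 1) * y ^ (3 - a - 1 - 1)))) := by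
    have hev : (fun z => deriv (fun z : ℝ => δ * (z ^ (1 - a) * (1 - M * (t - t₀) ^ 2) +
        K * z ^ (3 - a))) z) =ᶠ[𝓝 y] fun z => δ * ((1 - a) * z ^ (1 - a - 1) *
        (1 - M * (t - t₀) ^ 2) + K * ((3 - a) * z ^ (3 - a - 1))) := by
      filter_upwards [lt_mem_nhds hy] with z hz using e2 t z hz
    rw [hev.deriv_eq]
    exact ((((((r _ y hy).const_mul _).mul_const _).add
      (((r _ y hy).const_mul _).const_mul K)).const_mul δ)).deriv
  simp only [Ha, ptt, pyy, pt, py]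
  simp only [e1, e3, e4, e2 t y hy]
  have q1 : y ^ (1 - a - 1) = y ^ (1 - a) / y := by rw [rpow_sub_one hy.ne']
  have q2 : y ^ (1 - a - 1 - 1) = y ^ (1 - a) / y / y := by rw [rpow_sub_one hy.ne', q1]
  have q3 : y ^ (3 - a - 1 - 1) = y ^ (1 - a) := by congr 1; ring
  have q4 : y ^ (3 - a - 1) = y ^ (1 - a) * y := by
    rw [← rpow_add_one hy.ne']; congr 1; ring
  rw [q1, q2, q3, q4]
  field_simp
  ring

lemma neg_le_tanh_mul (t x : ℝ) : -|x| ≤ tanh t * x ∧ tanh t * x ≤ |x| := by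
  rw [← abs_le, abs_mul]
  exact mul_le_of_le_one_left (abs_nonneg x) (Real.abs_tanh_lt_one t).le

/-- Positivity of a nonnegative solution at a point propagates to every disc about that point. -/
lemma pos_of_Ha_eq_zero_of_pos_center {n : ℕ} (hn : 1 ≤ n) {a : ℝ} (ha : a ∈ Set.Ioo (-1:ℝ) 1)
    {u : ℝ → ℝ → ℝ} {B : Set (ℝ × ℝ)} (hB : IsOpen B) (hB0 : ∀ p ∈ B, 0 < p.2)
    (hsm : ContDiffOn ℝ 2 (fun p : ℝ × ℝ => u p.1 p.2) B)
    (hpos : ∀ p ∈ B, 0 ≤ u p.1 p.2) (heq : ∀ p ∈ B, Ha n a u p.1 p.2 = 0)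
    {t₁ y₁ R : ℝ} (hR : 0 < R) (hRB : ∀ p : ℝ × ℝ, (p.1 - t₁) ^ 2 + (p.2 - y₁) ^ 2 ≤ R ^ 2 → p ∈ B)
    (hu : 0 < u t₁ y₁) {p : ℝ × ℝ} (hp : (p.1 - t₁) ^ 2 + (p.2 - y₁) ^ 2 < R ^ 2) :
    0 < u p.1 p.2 := by
  have hcB : (t₁, y₁) ∈ B := hRB _ (by simp; positivity)
  have hyR : 0 < y₁ - R := hB0 _ (hRB (t₁, y₁ - R) (by simp))
  have hn1 : (0:ℝ) ≤ (n : ℝ) - 1 := by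
    have : (1:ℝ) ≤ n := by exact_mod_cast hn
    linarith
  obtain ⟨m, hm, hmu⟩ := exists_between hu
  obtain ⟨ρ, hρ, hρu⟩ : ∃ ρ > 0, ∀ p : ℝ × ℝ, (p.1 - t₁) ^ 2 + (p.2 - y₁) ^ 2 ≤ ρ ^ 2 →
      m ≤ u p.1 p.2 := by
    have hc : ContinuousAt (fun p : ℝ × ℝ => u p.1 p.2) (t₁, y₁) :=
      hsm.continuousOn.continuousAt (hB.mem_nhds hcB)
    obtain ⟨e, he, h⟩ := Metric.eventually_nhds_iff.1 (hc.eventually (lt_mem_nhds hmu))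
    refine ⟨e / 2, by positivity, fun p hp => (h ?_).le⟩
    rw [Prod.dist_eq, Real.dist_eq, Real.dist_eq]
    refine max_lt ?_ ?_ <;> refine lt_of_le_of_lt (abs_le_of_sq_le_sq (b := e / 2) ?_ ?_) ?_ <;>
      nlinarith [sq_nonneg (p.1 - t₁), sq_nonneg (p.2 - y₁)]
  set C := 4 + 2 * (R / (y₁ - R)) + 2 * (((n : ℝ) - 1) * R) with hC
  have hC0 : 0 < C := by positivity
  set α := C / (2 * ρ ^ 2) with hα
  have hα0 : 0 < α := by positivity
  have hαρ : 4 * α * ρ ^ 2 = 2 * C := by rw [hα]; field_simp; ring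
  set q : ℝ × ℝ → ℝ := fun p => (p.1 - t₁) ^ 2 + (p.2 - y₁) ^ 2 with hq
  have hqc : Continuous q := by fun_prop
  have hK : IsCompact {p | q p ≤ R ^ 2} := by
    refine (isCompact_Icc (a := (t₁ - R, y₁ - R)) (b := (t₁ + R, y₁ + R))).of_isClosed_subset
      (isClosed_le hqc continuous_const) ?_
    intro p hp
    have hp : (p.1 - t₁) ^ 2 + (p.2 - y₁) ^ 2 ≤ R ^ 2 := hp
    have h1 : |p.1 - t₁| ≤ R := abs_le_of_sq_le_sq (by nlinarith [sq_nonneg (p.2 - y₁)]) hR.le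
    have h2 : |p.2 - y₁| ≤ R := abs_le_of_sq_le_sq (by nlinarith [sq_nonneg (p.1 - t₁)]) hR.le
    rw [abs_le] at h1 h2
    exact ⟨⟨by simp; linarith, by simp; linarith⟩, ⟨by simp; linarith, by simp; linarith⟩⟩
  have key := le_of_Ha_lt (n := n) (a := a) (u := u)
    (w := fun t y => m * (exp (-α * ((t - t₁) ^ 2 + (y - y₁) ^ 2)) - exp (-α * R ^ 2))) hK
    (hsm.continuousOn.mono fun p hp => hRB p hp) (by fun_prop) ?_ p hp.le
  · refine lt_of_lt_of_le (mul_pos hm ?_) key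
    rw [sub_pos, exp_lt_exp]
    nlinarith
  rintro ⟨t, y⟩ hpK
  have hpB := hRB _ hpK
  simp only
  rcases le_or_gt (q (t, y)) (ρ ^ 2) with h1 | h1
  · left
    refine le_trans ?_ (hρu _ h1)
    have : exp (-α * ((t - t₁) ^ 2 + (y - y₁) ^ 2)) ≤ 1 := exp_le_one_iff.2 (by
      have : 0 ≤ α * ((t - t₁) ^ 2 + (y - y₁) ^ 2) := by positivity
      linarith)
    have := exp_pos (-α * R ^ 2)
    nlinarith
  rcases (show q (t, y) ≤ R ^ 2 from hpK).eq_or_lt with h2 | h2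
  · left
    have h2' : (t - t₁) ^ 2 + (y - y₁) ^ 2 = R ^ 2 := h2
    rw [h2', sub_self, mul_zero]
    exact hpos _ hpB
  right
  refine ⟨mem_of_superset ((isOpen_lt hqc continuous_const).mem_nhds h2) fun p hp =>
    (show q p < R ^ 2 from hp).le, hsm.contDiffAt (hB.mem_nhds hpB), ContDiff.contDiffAt (by fun_prop), ?_⟩
  rw [heq _ hpB, Ha_gaussian]
  refine mul_pos (mul_pos hm (exp_pos _)) (mul_pos hα0 ?_)
  have hqR : (t - t₁) ^ 2 + (y - y₁) ^ 2 ≤ R ^ 2 := hpK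
  have ht : |t - t₁| ≤ R := abs_le_of_sq_le_sq (by nlinarith [sq_nonneg (y - y₁)]) hR.le
  have hy : |y - y₁| ≤ R := abs_le_of_sq_le_sq (by nlinarith [sq_nonneg (t - t₁)]) hR.le
  have b1 : a / y * (y - y₁) ≤ R / (y₁ - R) := by
    have hyl : y₁ - R ≤ y := by linarith [(abs_le.1 hy).1]
    refine (le_abs_self _).trans ?_
    rw [abs_mul, abs_div, abs_of_pos (hyR.trans_le hyl), div_mul_eq_mul_div]
    refine div_le_div₀ hR.le ?_ hyR hyl
    exact (mul_le_of_le_one_left (abs_nonneg _) (abs_lt.2 ha).le).trans hy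
  have b2 : ((n : ℝ) - 1) * (tanh t * (t - t₁)) ≤ ((n : ℝ) - 1) * R :=
    mul_le_mul_of_nonneg_left ((neg_le_tanh_mul _ _).2.trans ht) hn1
  have b3 : 4 * α * ρ ^ 2 < 4 * α * ((t - t₁) ^ 2 + (y - y₁) ^ 2) :=
    mul_lt_mul_of_pos_left h1 (by positivity)
  linarith

/-- Strong maximum principle away from the degenerate boundary. -/
lemma pos_of_Ha_eq_zero {n : ℕ} (hn : 1 ≤ n) {a : ℝ} (ha : a ∈ Set.Ioo (-1:ℝ) 1)
    {u : ℝ → ℝ → ℝ} {B : Set (ℝ × ℝ)} (hB : IsOpen B) (hBc : IsPreconnected B)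
    (hB0 : ∀ p ∈ B, 0 < p.2)
    (hsm : ContDiffOn ℝ 2 (fun p : ℝ × ℝ => u p.1 p.2) B)
    (hpos : ∀ p ∈ B, 0 ≤ u p.1 p.2) (heq : ∀ p ∈ B, Ha n a u p.1 p.2 = 0)
    {p₁ : ℝ × ℝ} (hp₁ : p₁ ∈ B) (hu : 0 < u p₁.1 p₁.2) {p : ℝ × ℝ} (hp : p ∈ B) :
    0 < u p.1 p.2 := by
  suffices B ⊆ B ∩ (fun p : ℝ × ℝ => u p.1 p.2) ⁻¹' Ioi 0 from (this hp).2
  refine hBc.subset_of_closure_inter_subset (hsm.continuousOn.isOpen_inter_preimage hB isOpen_Ioi)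
    ⟨p₁, hp₁, hp₁, hu⟩ ?_
  rintro p₀ ⟨hcl, hp₀⟩
  refine ⟨hp₀, ?_⟩
  obtain ⟨e, he, heB⟩ := Metric.isOpen_iff.1 hB p₀ hp₀
  obtain ⟨x, ⟨hxB, hxu⟩, hx⟩ := Metric.mem_closure_iff.1 hcl (e / 4) (by positivity)
  rw [Prod.dist_eq, Real.dist_eq, Real.dist_eq, max_lt_iff, abs_lt, abs_lt] at hx
  obtain ⟨⟨h1, h2⟩, h3, h4⟩ := hx
  refine pos_of_Ha_eq_zero_of_pos_center hn ha hB hB0 hsm hpos heq (R := e / 2) (t₁ := x.1)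
    (y₁ := x.2) (by positivity) ?_ hxu (by nlinarith)
  intro z hz
  refine heB ?_
  have k1 := abs_le.1 (abs_le_of_sq_le_sq (a := z.1 - x.1) (b := e / 2)
    (by nlinarith [sq_nonneg (z.2 - x.2)]) (by positivity))
  have k2 := abs_le.1 (abs_le_of_sq_le_sq (a := z.2 - x.2) (b := e / 2)
    (by nlinarith [sq_nonneg (z.1 - x.1)]) (by positivity))
  rw [Metric.mem_ball, Prod.dist_eq, Real.dist_eq, Real.dist_eq, max_lt_iff, abs_lt, abs_lt]
  refine ⟨⟨?_, ?_⟩, ?_, ?_⟩ <;> linarith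

/-- Hopf-type lower bound at a point of the degenerate boundary. -/
lemma exists_mul_rpow_le {n : ℕ} (hn : 1 ≤ n) {a : ℝ} (ha : a ∈ Set.Ioo (-1:ℝ) 1)
    {u : ℝ → ℝ → ℝ} {t₀ r : ℝ} (hr : 0 < r)
    (hcont : ContinuousOn (fun p : ℝ × ℝ => u p.1 p.2) (Icc (t₀ - r) (t₀ + r) ×ˢ Icc 0 r))
    (hnonneg : ∀ p ∈ Icc (t₀ - r) (t₀ + r) ×ˢ Icc 0 r, 0 ≤ u p.1 p.2)
    (hpos : ∀ p ∈ Icc (t₀ - r) (t₀ + r) ×ˢ Ioc 0 r, 0 < u p.1 p.2)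
    (hsm : ∀ p ∈ Ioo (t₀ - r) (t₀ + r) ×ˢ Ioo 0 r,
      ContDiffAt ℝ 2 (fun p : ℝ × ℝ => u p.1 p.2) p)
    (heq : ∀ p ∈ Ioo (t₀ - r) (t₀ + r) ×ˢ Ioo 0 r, Ha n a u p.1 p.2 = 0) :
    ∃ δ > 0, ∃ Y > 0, Y ≤ r ∧ ∀ y ∈ Icc 0 Y, δ * y ^ (1 - a) ≤ u t₀ y := by
  obtain ⟨ha1, ha2⟩ := ha
  have hn1 : (0:ℝ) ≤ (n : ℝ) - 1 := by
    have : (1:ℝ) ≤ n := by exact_mod_cast hn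
    linarith
  set M := 2 / r ^ 2 with hM
  have hM0 : 0 < M := by positivity
  have hMr : M * r ^ 2 = 2 := by rw [hM]; field_simp
  set κ := M * (1 + r * ((n : ℝ) - 1)) with hκ
  have hκ0 : 0 < κ := by positivity
  set Y := min r (1 / (κ + 1)) with hY
  have hY0 : 0 < Y := lt_min hr (by positivity)
  have hYr : Y ≤ r := min_le_left _ _
  have hYκ : κ * Y ^ 2 ≤ 1 := by
    have h : Y ≤ 1 / (κ + 1) := min_le_right _ _
    rw [le_div_iff₀ (by positivity)] at h
    nlinarith [mul_pos hκ0 hY0]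
  have hK : IsCompact (Icc (t₀ - r) (t₀ + r) ×ˢ Icc 0 Y) := isCompact_Icc.prod isCompact_Icc
  have hKs : Icc (t₀ - r) (t₀ + r) ×ˢ Icc 0 Y ⊆ Icc (t₀ - r) (t₀ + r) ×ˢ Icc 0 r :=
    prod_mono_right (Icc_subset_Icc_right hYr)
  obtain ⟨m, hm, hmu⟩ : ∃ m > 0, ∀ t ∈ Icc (t₀ - r) (t₀ + r), m ≤ u t Y := by
    have hc : ContinuousOn (fun t => u t Y) (Icc (t₀ - r) (t₀ + r)) :=
      hcont.comp (f := fun t : ℝ => (t, Y)) (by fun_prop) fun t ht => ⟨ht, hY0.le, hYr⟩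
    obtain ⟨s, hs, hmin⟩ := isCompact_Icc.exists_isMinOn
      (nonempty_Icc.2 (by linarith : t₀ - r ≤ t₀ + r)) hc
    exact ⟨u s Y, hpos (s, Y) ⟨hs, hY0, hYr⟩, fun t ht => hmin ht⟩
  have hYp : 0 < Y ^ (1 - a) := rpow_pos_of_pos hY0 _
  set δ := m / (2 * Y ^ (1 - a)) with hδ
  have hδ0 : 0 < δ := by positivity
  have hδY : δ * Y ^ (1 - a) * 2 = m := by rw [hδ]; field_simp
  have hpow : ∀ y : ℝ, 0 ≤ y → y ^ (3 - a) = y ^ (1 - a) * y ^ 2 := by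
    intro y hy
    rw [show (3 - a) = (1 - a) + (2 : ℕ) by push_cast; ring, rpow_add_natCast' hy (by
      push_cast; linarith)]
  have key := le_of_Ha_lt (n := n) (a := a) (u := u) (w := fun t y =>
    δ * (y ^ (1 - a) * (1 - M * (t - t₀) ^ 2) + κ * y ^ (3 - a))) hK (hcont.mono hKs) ?_ ?_
  · refine ⟨δ, hδ0, Y, hY0, hYr, fun y hy => ?_⟩
    have h := key (t₀, y) ⟨⟨by simp; linarith, by simp; linarith⟩, hy⟩
    refine le_trans ?_ h
    have : 0 ≤ κ * y ^ (3 - a) := mul_nonneg hκ0.le (rpow_nonneg hy.1 _)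
    simp only [sub_self]
    gcongr
    linarith
  · have h1 : Continuous fun y : ℝ => y ^ (1 - a) := continuous_rpow_const (by linarith)
    have h3 : Continuous fun y : ℝ => y ^ (3 - a) := continuous_rpow_const (by linarith)
    have h1' := h1.comp (continuous_snd (X := ℝ))
    have h3' := h3.comp (continuous_snd (X := ℝ))
    exact (continuous_const.mul ((h1'.mul (by fun_prop)).add
      (continuous_const.mul h3'))).continuousOn
  rintro ⟨t, y⟩ ⟨⟨ht1, ht2⟩, hy1, hy2⟩
  simp only at ht1 ht2 hy1 hy2 ⊢
  have hu0 : 0 ≤ u t y := hnonneg (t, y) (hKs ⟨⟨ht1, ht2⟩, hy1, hy2⟩)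
  have hfac : δ * (y ^ (1 - a) * (1 - M * (t - t₀) ^ 2) + κ * y ^ (3 - a)) =
      δ * y ^ (1 - a) * (1 - M * (t - t₀) ^ 2 + κ * y ^ 2) := by rw [hpow y hy1]; ring
  by_cases hside : 1 - M * (t - t₀) ^ 2 + κ * y ^ 2 ≤ 0
  · left
    rw [hfac]
    exact (mul_nonpos_of_nonneg_of_nonpos (by positivity) hside).trans hu0
  rcases hy1.eq_or_lt with rfl | hy0
  · left
    rwa [hfac, zero_rpow (by linarith), mul_zero, zero_mul]
  rcases hy2.eq_or_lt with rfl | hyY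
  · left
    rw [hfac]
    refine le_trans ?_ (hmu t ⟨ht1, ht2⟩)
    rw [← hδY]
    have : 0 ≤ M * (t - t₀) ^ 2 := by positivity
    gcongr
    linarith
  right
  have hy2κ : κ * y ^ 2 ≤ 1 := le_trans (by gcongr) hYκ
  have hsq : (t - t₀) ^ 2 < r ^ 2 := by
    by_contra! h
    have := mul_le_mul_of_nonneg_left h hM0.le
    exact hside (by linarith)
  have habs := abs_lt_of_sq_lt_sq hsq hr.le
  have habs' := abs_lt.1 habs
  have hIoo : (t, y) ∈ Ioo (t₀ - r) (t₀ + r) ×ˢ Ioo 0 Y :=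
    ⟨⟨by simp; linarith, by simp; linarith⟩, hy0, hyY⟩
  have hIoo' : (t, y) ∈ Ioo (t₀ - r) (t₀ + r) ×ˢ Ioo 0 r :=
    prod_mono_right (Ioo_subset_Ioo_right hYr) hIoo
  refine ⟨mem_of_superset ((isOpen_Ioo.prod isOpen_Ioo).mem_nhds hIoo)
    (Set.prod_mono Ioo_subset_Icc_self Ioo_subset_Icc_self), hsm _ hIoo', ?_, ?_⟩
  · have hp : ∀ p : ℝ, ContDiffAt ℝ 2 (fun q : ℝ × ℝ => q.2 ^ p) (t, y) := fun p =>
      contDiffAt_snd.rpow_const_of_ne hy0.ne'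
    exact contDiffAt_const.mul (((hp _).mul (by fun_prop)).add (contDiffAt_const.mul (hp _)))
  rw [heq _ hIoo', Ha_rpow _ _ _ _ _ _ _ hy0]
  refine mul_pos (mul_pos hδ0 (rpow_pos_of_pos hy0 _)) ?_
  have b : ((n : ℝ) - 1) * (tanh t * (t - t₀)) ≤ ((n : ℝ) - 1) * r :=
    mul_le_mul_of_nonneg_left ((neg_le_tanh_mul _ _).2.trans habs.le) hn1
  have b' := mul_le_mul_of_nonneg_left b hM0.le
  have : M * (((n : ℝ) - 1) * r) = κ - M := by rw [hκ]; ring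
  nlinarith

/-- A function vanishing at `0` and bounded below by a positive multiple of `y ^ (1 - a)` has a
nonvanishing conormal derivative. -/
lemma not_tendsto_rpow_mul_deriv_zero {a δ Y : ℝ} (ha : a < 1) (hδ : 0 < δ) (hY : 0 < Y)
    {f : ℝ → ℝ} (hf : ContinuousOn f (Icc 0 Y)) (hfd : ∀ y ∈ Ioo 0 Y, DifferentiableAt ℝ f y)
    (hf0 : f 0 = 0) (hle : ∀ y ∈ Icc 0 Y, δ * y ^ (1 - a) ≤ f y) :
    ¬ Tendsto (fun y : ℝ => y ^ a * deriv f y) (𝓝[>] (0:ℝ)) (𝓝 0) := by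
  intro h
  have hc : 0 < δ * (1 - a) := mul_pos hδ (by linarith)
  obtain ⟨η, hη, hηd⟩ := mem_nhdsGT_iff_exists_Ioo_subset.1 (h.eventually (gt_mem_nhds hc))
  have hη : 0 < η := hη
  set ζ := min η Y with hζ
  have hζ0 : 0 < ζ := lt_min hη hY
  have hanti : StrictAntiOn (fun y => f y - δ * y ^ (1 - a)) (Icc 0 ζ) := by
    refine strictAntiOn_of_deriv_neg (convex_Icc _ _) ?_ ?_
    · refine (hf.mono (Icc_subset_Icc_right (min_le_right _ _))).sub (Continuous.continuousOn ?_)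
      exact continuous_const.mul (continuous_rpow_const (by linarith))
    · intro y hy
      rw [interior_Icc] at hy
      have h1 : y ^ a * deriv f y < δ * (1 - a) := hηd ⟨hy.1, hy.2.trans_le (min_le_left _ _)⟩
      have hd := (hfd y ⟨hy.1, hy.2.trans_le (min_le_right _ _)⟩).hasDerivAt.sub
        ((Real.hasDerivAt_rpow_const (p := 1 - a) (Or.inl hy.1.ne')).const_mul δ)
      refine hd.deriv.trans_lt ?_
      rw [show 1 - a - 1 = -a by ring, rpow_neg hy.1.le, sub_neg, ← mul_assoc,
        ← div_eq_mul_inv, lt_div_iff₀ (rpow_pos_of_pos hy.1 _)]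
      linarith
  have h1 := hanti (left_mem_Icc.2 hζ0.le) (right_mem_Icc.2 hζ0.le) hζ0
  have h2 := hle ζ ⟨hζ0.le, min_le_right _ _⟩
  simp only [hf0, zero_rpow (by linarith : 1 - a ≠ 0)] at h1
  linarith

/-- Strong maximum principle with a Robin-type boundary condition: if `u ≥ 0` solves
`H_a u = 0` in the half-disc `B` centered at `(b,0)` of radius `ε`, with
`-lim_{y→0⁺} y^a ∂_y u(t,y) + d(t) u(t,0) = 0` on the flat part `Γ⁰`, then either
`u ≡ 0` on `B` or `u > 0` on `B ∪ Γ⁰`. -/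
theorem stmt15 (n : ℕ) (hn : 2 ≤ n) (a : ℝ) (ha : a ∈ Set.Ioo (-1:ℝ) 1)
    (b ε : ℝ) (hε : 0 < ε) (d : ℝ → ℝ)
    (hd : ContinuousOn d (Set.Ioo (b - ε) (b + ε))) (u : ℝ → ℝ → ℝ)
    (hcont : ContinuousOn (fun p : ℝ × ℝ => u p.1 p.2)
      (closure {p : ℝ × ℝ | (p.1 - b) ^ 2 + p.2 ^ 2 < ε ^ 2 ∧ 0 < p.2}))
    (hsm : ContDiffOn ℝ 2 (fun p : ℝ × ℝ => u p.1 p.2)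
      {p : ℝ × ℝ | (p.1 - b) ^ 2 + p.2 ^ 2 < ε ^ 2 ∧ 0 < p.2})
    (hpos : ∀ p ∈ {p : ℝ × ℝ | (p.1 - b) ^ 2 + p.2 ^ 2 < ε ^ 2 ∧ 0 < p.2},
      0 ≤ u p.1 p.2)
    (heq : ∀ t y : ℝ, (t - b) ^ 2 + y ^ 2 < ε ^ 2 → 0 < y → Ha n a u t y = 0)
    (hbc : ∀ t : ℝ, |t - b| < ε →
      Tendsto (fun y : ℝ => y ^ a * py u t y) (𝓝[>] (0:ℝ)) (𝓝 (d t * u t 0))) :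
    (∀ p ∈ {p : ℝ × ℝ | (p.1 - b) ^ 2 + p.2 ^ 2 < ε ^ 2 ∧ 0 < p.2}, u p.1 p.2 = 0) ∨
    (∀ p ∈ {p : ℝ × ℝ | (p.1 - b) ^ 2 + p.2 ^ 2 < ε ^ 2 ∧ 0 < p.2} ∪
        {p : ℝ × ℝ | |p.1 - b| < ε ∧ p.2 = 0}, 0 < u p.1 p.2) := by
  set B := {p : ℝ × ℝ | (p.1 - b) ^ 2 + p.2 ^ 2 < ε ^ 2 ∧ 0 < p.2} with hBdef
  have hB : IsOpen B :=
    (isOpen_lt (f := fun p : ℝ × ℝ => (p.1 - b) ^ 2 + p.2 ^ 2) (by fun_prop)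
      continuous_const).inter (isOpen_lt continuous_const continuous_snd)
  have hBc : IsPreconnected B := by
    refine Convex.isPreconnected ?_
    rintro p ⟨hp1, hp2⟩ q ⟨hq1, hq2⟩ s t hs ht hst
    have hsum : 0 < s * p.2 + t * q.2 := by
      rcases hs.eq_or_lt with rfl | hs
      · have : t = 1 := by linarith
        simpa [this] using hq2
      · positivity
    refine ⟨?_, hsum⟩
    obtain rfl : t = 1 - s := by linarith
    simp only [Prod.fst_add, Prod.smul_fst, Prod.snd_add, Prod.smul_snd, smul_eq_mul]
    have h1 : 0 ≤ s * (1 - s) * ((p.1 - q.1) ^ 2 + (p.2 - q.2) ^ 2) := by positivity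
    have h2 : s * ((p.1 - b) ^ 2 + p.2 ^ 2) + (1 - s) * ((q.1 - b) ^ 2 + q.2 ^ 2) < ε ^ 2 := by
      rcases hs.eq_or_lt with rfl | hs
      · simpa using hq1
      · nlinarith [mul_lt_mul_of_pos_left hp1 hs, mul_le_mul_of_nonneg_left hq1.le ht]
    nlinarith
  have hn1 : 1 ≤ n := by omega
  by_cases hzero : ∀ p ∈ B, u p.1 p.2 = 0
  · exact Or.inl hzero
  right
  push Not at hzero
  obtain ⟨p₁, hp₁, hne⟩ := hzero
  have hBpos : ∀ p ∈ B, 0 < u p.1 p.2 := fun p hp =>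
    pos_of_Ha_eq_zero hn1 ha hB hBc (fun p hp => hp.2) hsm hpos
      (fun p hp => heq p.1 p.2 hp.1 hp.2) hp₁ ((hpos p₁ hp₁).lt_of_ne' hne) hp
  rintro p (hp | ⟨hp1, hp2⟩)
  · exact hBpos p hp
  obtain ⟨t₀, y₀⟩ := p
  simp only at hp1 hp2 ⊢
  subst hp2
  set r := (ε - |t₀ - b|) / 2 with hr
  have hr0 : 0 < r := by linarith [hp1]
  have hrB : ∀ p ∈ Icc (t₀ - r) (t₀ + r) ×ˢ Ioc 0 r, p ∈ B := by
    rintro ⟨t, y⟩ ⟨⟨ht1, ht2⟩, hy1, hy2⟩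
    simp only at ht1 ht2 hy1 hy2
    refine ⟨?_, hy1⟩
    have hle : |t - b| ≤ ε - r := by
      have h := abs_le.1 (show |t₀ - b| ≤ ε - 2 * r by linarith)
      rw [abs_le]
      constructor <;> linarith
    have h1 : (t - b) ^ 2 ≤ (ε - r) ^ 2 := by
      rw [← sq_abs]
      gcongr
    have h2 : r ≤ ε / 2 := by linarith [abs_nonneg (t₀ - b)]
    simp only
    nlinarith
  have hrcl : Icc (t₀ - r) (t₀ + r) ×ˢ Icc 0 r ⊆ closure B := by
    rw [← closure_Ioc hr0.ne, ← (isClosed_Icc (a := t₀ - r) (b := t₀ + r)).closure_eq,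
      ← closure_prod_eq]
    exact closure_mono hrB
  have hcl : ∀ p ∈ closure B, 0 ≤ u p.1 p.2 :=
    fun p hp => le_on_closure (f := fun _ => 0) hpos continuousOn_const hcont hp
  have hIoo : Ioo (t₀ - r) (t₀ + r) ×ˢ Ioo 0 r ⊆ B :=
    (Set.prod_mono Ioo_subset_Icc_self Ioo_subset_Ioc_self).trans hrB
  have ht₀ : t₀ ∈ Icc (t₀ - r) (t₀ + r) := ⟨by linarith, by linarith⟩
  obtain ⟨δ, hδ, Y, hY, hYr, hle⟩ := exists_mul_rpow_le hn1 ha hr0 (hcont.mono hrcl)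
    (fun p hp => hcl p (hrcl hp)) (fun p hp => hBpos p (hrB p hp))
    (fun p hp => hsm.contDiffAt (hB.mem_nhds (hIoo hp)))
    (fun p hp => heq p.1 p.2 (hIoo hp).1 (hIoo hp).2)
  refine (hcl (t₀, 0) (hrcl ⟨ht₀, le_rfl, hr0.le⟩)).lt_of_ne' fun h0 => ?_
  simp only at h0
  have hlim := hbc t₀ hp1
  rw [h0, mul_zero] at hlim
  refine not_tendsto_rpow_mul_deriv_zero ha.2 hδ hY (f := fun y => u t₀ y) ?_ ?_ h0 hle hlim
  · exact hcont.comp (f := fun y : ℝ => (t₀, y)) (by fun_prop)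
      fun y hy => hrcl ⟨ht₀, hy.1, hy.2.trans hYr⟩
  · intro y hy
    have hmem : (t₀, y) ∈ B := hrB _ ⟨ht₀, hy.1, hy.2.le.trans hYr⟩
    exact (ContDiffAt.comp (g := fun p : ℝ × ℝ => u p.1 p.2) (f := fun y : ℝ => (t₀, y)) y
      (hsm.contDiffAt (hB.mem_nhds hmem)) (by fun_prop)).differentiableAt (by norm_num)
end

section
/- Let n ≥ 2 be an integer, a ∈ (−1,1), and let d : ℝ → ℝ be a bounded function. Suppose u : ℝ × [0,∞) → ℝ is bounded, continuous on ℝ × [0,∞), twice continuously differentiable on ℝ × (0,∞), satisfies H_a u = 0 on ℝ × (0,∞), for every t ∈ ℝ the limit lim_{y→0⁺} y^a ∂_y u(t,y) exists and −lim_{y→0⁺} y^a ∂_y u(t,y) + d(t) u(t,0) ≥ 0, and u(t,0) → 0 as t → +∞ and as t → −∞. Assume there exists a nonempty set Σ ⊆ ℝ such that u(t,0) > 0 for every t ∈ Σ and d(t) ≥ 0 for every t ∉ Σ. Then u > 0 on ℝ × [0,∞). -/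
open Real Filter MeasureTheory Set Topology

/-- Second derivative test at a local minimum, with explicit first and second derivatives. -/
lemma IsLocalMin.hasDerivAt_hasDerivAt_nonneg {f F : ℝ → ℝ} {x A : ℝ} (h : IsLocalMin f x)
    (hF : ∀ᶠ s in 𝓝 x, HasDerivAt f (F s) s) (hA : HasDerivAt F A x) : F x = 0 ∧ 0 ≤ A := by
  have hx : HasDerivAt f (F x) x := hF.self_of_nhds
  have hF0 : F x = 0 := h.hasDerivAt_eq_zero hx
  have hd : deriv f =ᶠ[𝓝 x] F := hF.mono fun s hs => hs.deriv
  have hdd : deriv (deriv f) x = A := by rw [hd.deriv_eq, hA.deriv]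
  refine ⟨hF0, ?_⟩
  by_contra! hneg
  have hmax : IsLocalMax f x :=
    isLocalMax_of_deriv_deriv_neg (by rw [hdd]; exact hneg) (by rw [hx.deriv, hF0])
      hx.continuousAt
  have hconst : f =ᶠ[𝓝 x] fun _ => f x := by
    filter_upwards [h, hmax] with s h1 h2
    exact le_antisymm h2 h1
  have h0 : deriv f =ᶠ[𝓝 x] fun _ => 0 := by
    have := hconst.deriv
    simpa using this
  have : deriv (deriv f) x = 0 := by rw [h0.deriv_eq]; simp
  linarith

/-- `φ` is twice differentiable along the coordinate lines through `(t, y)`, and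
`H_a φ (t, y) > 0`. -/
def IsStrictSubsolutionAt (n : ℕ) (a : ℝ) (φ : ℝ → ℝ → ℝ) (t y : ℝ) : Prop :=
  ∃ (φt φy : ℝ → ℝ) (A B : ℝ),
    (∀ᶠ s in 𝓝 t, HasDerivAt (fun s => φ s y) (φt s) s) ∧ HasDerivAt φt A t ∧
    (∀ᶠ z in 𝓝 y, HasDerivAt (fun z => φ t z) (φy z) z) ∧ HasDerivAt φy B y ∧
    0 < B + (a / y) * φy y + A + ((n : ℝ) - 1) * Real.tanh t * φt t

lemma ContDiffAt.eventually_hasDerivAt_deriv {f : ℝ → ℝ} {x : ℝ} (h : ContDiffAt ℝ 2 f x) :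
    (∀ᶠ s in 𝓝 x, HasDerivAt f (deriv f s) s) ∧ HasDerivAt (deriv f) (deriv (deriv f) x) x := by
  constructor
  · filter_upwards [h.eventually (by simp)] with s hs
    exact (hs.differentiableAt (by simp)).hasDerivAt
  · have h1 : ContDiffAt ℝ 1 (deriv f) x :=
      h.derivWithin (by norm_num)
    exact (h1.differentiableAt (by simp)).hasDerivAt

section

variable {n : ℕ} {a : ℝ} {u : ℝ → ℝ → ℝ}

lemma contDiffAt_slices (hsm : ContDiffOn ℝ 2 (fun p : ℝ × ℝ => u p.1 p.2) {p : ℝ × ℝ | 0 < p.2})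
    {t y : ℝ} (hy : 0 < y) :
    ContDiffAt ℝ 2 (fun s => u s y) t ∧ ContDiffAt ℝ 2 (fun z => u t z) y := by
  have hopen : IsOpen {p : ℝ × ℝ | 0 < p.2} := isOpen_lt continuous_const continuous_snd
  have hat : ContDiffAt ℝ 2 (fun p : ℝ × ℝ => u p.1 p.2) (t, y) :=
    hsm.contDiffAt (hopen.mem_nhds hy)
  exact ⟨ContDiffAt.comp (f := fun s : ℝ => (s, y)) t hat (contDiffAt_id.prodMk contDiffAt_const),
    ContDiffAt.comp (f := fun z : ℝ => (t, z)) y hat (contDiffAt_const.prodMk contDiffAt_id)⟩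

/-- Comparison principle: a strict subsolution lying below the solution `u` on the rest of the
compact set `K` lies below `u` on all of `K`. -/
lemma le_of_isStrictSubsolutionAt
    (hcont : ContinuousOn (fun p : ℝ × ℝ => u p.1 p.2) {p : ℝ × ℝ | 0 ≤ p.2})
    (hsm : ContDiffOn ℝ 2 (fun p : ℝ × ℝ => u p.1 p.2) {p : ℝ × ℝ | 0 < p.2})
    (heq : ∀ t y : ℝ, 0 < y → Ha n a u t y = 0)
    {K : Set (ℝ × ℝ)} (hK : IsCompact K) (hK0 : ∀ p ∈ K, 0 ≤ p.2) {φ : ℝ → ℝ → ℝ}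
    (hφ : ContinuousOn (fun p : ℝ × ℝ => φ p.1 p.2) K)
    (h : ∀ p ∈ K, φ p.1 p.2 ≤ u p.1 p.2 ∨
      0 < p.2 ∧ K ∈ 𝓝 p ∧ IsStrictSubsolutionAt n a φ p.1 p.2) :
    ∀ p ∈ K, φ p.1 p.2 ≤ u p.1 p.2 := by
  intro q hq
  obtain ⟨⟨t, y⟩, hpK, hmin⟩ := hK.exists_isMinOn ⟨q, hq⟩ ((hcont.mono hK0).sub hφ)
  have hqp : u t y - φ t y ≤ u q.1 q.2 - φ q.1 q.2 := hmin hq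
  rcases h _ hpK with h1 | ⟨hy, hKn, φt, φy, A, B, h1, h2, h3, h4, h5⟩
  · dsimp only at h1
    linarith
  exfalso
  dsimp only at hy h1 h2 h3 h4 h5
  have hloc : IsLocalMin (fun p : ℝ × ℝ => u p.1 p.2 - φ p.1 p.2) (t, y) :=
    hmin.isLocalMin hKn
  have hlt : IsLocalMin (fun s => u s y - φ s y) t :=
    ((by fun_prop : Continuous fun s : ℝ => (s, y)).tendsto t).eventually hloc
  have hly : IsLocalMin (fun z => u t z - φ t z) y :=
    ((by fun_prop : Continuous fun z : ℝ => (t, z)).tendsto y).eventually hloc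
  obtain ⟨hut, huy⟩ := contDiffAt_slices hsm (t := t) hy
  obtain ⟨ht1, ht2⟩ := hut.eventually_hasDerivAt_deriv
  obtain ⟨hy1, hy2⟩ := huy.eventually_hasDerivAt_deriv
  obtain ⟨e1, e2⟩ := hlt.hasDerivAt_hasDerivAt_nonneg
    (ht1.and h1 |>.mono fun s hs => hs.1.sub hs.2) (ht2.sub h2)
  obtain ⟨e3, e4⟩ := hly.hasDerivAt_hasDerivAt_nonneg
    (hy1.and h3 |>.mono fun s hs => hs.1.sub hs.2) (hy2.sub h4)
  have hH : deriv (deriv fun z => u t z) y + (a / y) * deriv (fun z => u t z) y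
      + deriv (deriv fun s => u s y) t
      + ((n : ℝ) - 1) * Real.tanh t * deriv (fun s => u s y) t = 0 := heq t y hy
  have e1' : deriv (fun s => u s y) t - φt t = 0 := e1
  have e3' : deriv (fun z => u t z) y - φy y = 0 := e3
  rw [sub_eq_zero.1 e1', sub_eq_zero.1 e3'] at hH
  linarith

lemma Icc_prod_Icc_mem_nhds {t y t₁ t₂ y₁ y₂ : ℝ} (h1 : t₁ < t) (h2 : t < t₂) (h3 : y₁ < y)
    (h4 : y < y₂) : Icc t₁ t₂ ×ˢ Icc y₁ y₂ ∈ 𝓝 (t, y) :=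
  prod_mem_nhds (Icc_mem_nhds h1 h2) (Icc_mem_nhds h3 h4)

lemma abs_natCast_sub_one_mul_tanh_mul_le (hn : 2 ≤ n) (t : ℝ) {x c : ℝ} (hx : |x| ≤ c) :
    |((n : ℝ) - 1) * Real.tanh t * x| ≤ ((n : ℝ) - 1) * c := by
  have hn' : (2 : ℝ) ≤ n := by exact_mod_cast hn
  have ht : |Real.tanh t| ≤ 1 := (Real.abs_tanh_lt_one t).le
  rw [mul_assoc, abs_mul, abs_mul, abs_of_nonneg (by linarith : (0 : ℝ) ≤ (n : ℝ) - 1)]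
  gcongr
  · linarith
  · nlinarith [abs_nonneg x, abs_nonneg (Real.tanh t)]

lemma abs_two_mul_div_one_add_sq_le (s : ℝ) : |2 * s / (1 + s ^ 2)| ≤ 1 := by
  rw [abs_div, abs_of_pos (by positivity : 0 < 1 + s ^ 2), div_le_one (by positivity), abs_le]
  constructor <;> nlinarith [sq_nonneg (s + 1), sq_nonneg (s - 1)]

lemma deriv_two_mul_div_one_add_sq_le (s : ℝ) :
    (2 * (1 + s ^ 2) - 2 * s * (2 * s)) / (1 + s ^ 2) ^ 2 ≤ 2 := by
  rw [div_le_iff₀ (by positivity)]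
  nlinarith [sq_nonneg s, sq_nonneg (s ^ 2)]

/-- Phragmén–Lindelöf principle: a lower bound at `y = 0` propagates to the half-plane. -/
lemma le_of_le_boundary (hn : 2 ≤ n) (ha : a ∈ Ioo (-1 : ℝ) 1)
    (hb : ∃ M : ℝ, ∀ t y : ℝ, 0 ≤ y → |u t y| ≤ M)
    (hcont : ContinuousOn (fun p : ℝ × ℝ => u p.1 p.2) {p : ℝ × ℝ | 0 ≤ p.2})
    (hsm : ContDiffOn ℝ 2 (fun p : ℝ × ℝ => u p.1 p.2) {p : ℝ × ℝ | 0 < p.2})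
    (heq : ∀ t y : ℝ, 0 < y → Ha n a u t y = 0) {m : ℝ} (hm : m ≤ 0)
    (hbd : ∀ t, m ≤ u t 0) (t y : ℝ) (hy : 0 ≤ y) : m ≤ u t y := by
  obtain ⟨M, hM⟩ := hb
  have hM0 : 0 ≤ M := (abs_nonneg _).trans (hM 0 0 le_rfl)
  have hlow : ∀ t y, 0 ≤ y → -M ≤ u t y := fun t y hy => (abs_le.1 (hM t y hy)).1
  obtain ⟨ha1, ha2⟩ := ha
  have hn' : (2 : ℝ) ≤ n := by exact_mod_cast hn
  set N : ℝ := (n + 2) / (2 * (1 + a)) with hN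
  have hN2 : 2 * N * (1 + a) = n + 2 := by
    rw [hN]; field_simp [(by linarith : (1 + a) ≠ 0)]
  have hN0 : 0 < N := by rw [hN]; apply div_pos <;> linarith
  -- comparison on a rectangle
  have key : ∀ Y, 0 < Y → y ≤ Y → ∀ ε, 0 < ε →
      m - M / Y ^ (1 - a) * y ^ (1 - a) - ε * (log (1 + t ^ 2) + N * (Y ^ 2 - y ^ 2)) ≤ u t y := by
    intro Y hY hyY ε hε
    set R : ℝ := |t| + exp (M / ε) with hR
    have hRt : |t| ≤ R := by have := exp_pos (M / ε); linarith
    have hRe : exp (M / ε) ≤ R := by have := abs_nonneg t; linarith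
    have hR1 : 1 ≤ R := (one_le_exp (by positivity)).trans hRe
    have hlogR : M ≤ ε * log (1 + R ^ 2) := by
      have : M / ε ≤ log (1 + R ^ 2) := by
        rw [le_log_iff_exp_le (by positivity)]
        nlinarith
      rwa [div_le_iff₀' hε] at this
    have hYp : 0 < Y ^ (1 - a) := rpow_pos_of_pos hY _
    refine le_of_isStrictSubsolutionAt hcont hsm heq (K := Icc (-R) R ×ˢ Icc 0 Y)
      (φ := fun t y => m - M / Y ^ (1 - a) * y ^ (1 - a)
        - ε * (log (1 + t ^ 2) + N * (Y ^ 2 - y ^ 2)))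
      (isCompact_Icc.prod isCompact_Icc) (fun p hp => hp.2.1) ?_ ?_ (t, y)
      ⟨abs_le.1 hRt, hy, hyY⟩
    · apply Continuous.continuousOn
      have h1 : Continuous fun p : ℝ × ℝ => p.2 ^ (1 - a) :=
        continuous_snd.rpow_const fun _ => Or.inr (by linarith)
      have h2 : Continuous fun p : ℝ × ℝ => log (1 + p.1 ^ 2) :=
        Continuous.log (by fun_prop) fun p => by positivity
      fun_prop
    · rintro ⟨s, z⟩ ⟨⟨hs1, hs2⟩, hz1, hz2⟩
      dsimp only at hs1 hs2 hz1 hz2 ⊢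
      have hls : 0 ≤ log (1 + s ^ 2) := log_nonneg (by nlinarith)
      have hq : 0 ≤ N * (Y ^ 2 - z ^ 2) := mul_nonneg hN0.le (by nlinarith)
      have hp : 0 ≤ M / Y ^ (1 - a) * z ^ (1 - a) := by positivity
      rcases hz1.eq_or_lt with rfl | hz0
      · left
        have := hbd s
        nlinarith
      rcases hz2.eq_or_lt with rfl | hzY
      · left
        have := hlow s z hz1
        rw [div_mul_cancel₀ _ hYp.ne']
        nlinarith
      by_cases hsR : s ^ 2 = R ^ 2
      · left
        have := hlow s z hz1
        rw [hsR]
        nlinarith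
      have hs1' : -R < s := lt_of_le_of_ne hs1 fun h => hsR (by rw [← h]; ring)
      have hs2' : s < R := lt_of_le_of_ne hs2 fun h => hsR (by rw [← h])
      right
      refine ⟨hz0, Icc_prod_Icc_mem_nhds hs1' hs2' hz0 hzY,
        fun s => -(ε * (2 * s / (1 + s ^ 2))),
        fun z => -(M / Y ^ (1 - a) * ((1 - a) * z ^ (-a))) + ε * (N * (2 * z)),
        -(ε * ((2 * (1 + s ^ 2) - 2 * s * (2 * s)) / (1 + s ^ 2) ^ 2)),
        -(M / Y ^ (1 - a) * ((1 - a) * (-a * z ^ (-a - 1)))) + ε * (N * 2), ?_, ?_, ?_, ?_, ?_⟩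
      · refine Eventually.of_forall fun s => ?_
        have h1 : HasDerivAt (fun s : ℝ => 1 + s ^ 2) (2 * s) s := by
          simpa using (hasDerivAt_pow 2 s).const_add 1
        have h2 := h1.log (by positivity)
        exact (((h2.add_const _).const_mul ε).const_sub _)
      · have h1 : HasDerivAt (fun s : ℝ => 1 + s ^ 2) (2 * s) s := by
          simpa using (hasDerivAt_pow 2 s).const_add 1
        have h0 : HasDerivAt (fun s : ℝ => 2 * s) 2 s := by
          simpa using (hasDerivAt_id s).const_mul 2
        exact ((h0.fun_div h1 (by positivity)).const_mul ε).fun_neg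
      · filter_upwards [lt_mem_nhds hz0] with z hz
        have h1 : HasDerivAt (fun z : ℝ => z ^ (1 - a)) ((1 - a) * z ^ (-a)) z := by
          have := hasDerivAt_rpow_const (x := z) (p := 1 - a) (Or.inl hz.ne')
          rwa [show 1 - a - 1 = -a by ring] at this
        have h2 : HasDerivAt (fun z : ℝ => z ^ 2) (2 * z) z := by
          simpa using hasDerivAt_pow 2 z
        have := ((h1.const_mul (M / Y ^ (1 - a))).const_sub m).fun_sub
          ((((h2.const_sub (Y ^ 2)).const_mul N).const_add (log (1 + s ^ 2))).const_mul ε)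
        refine this.congr_deriv ?_
        ring
      · have h1 : HasDerivAt (fun z : ℝ => z ^ (-a)) (-a * z ^ (-a - 1)) z :=
          hasDerivAt_rpow_const (Or.inl hz0.ne')
        have h2 : HasDerivAt (fun z : ℝ => 2 * z) 2 z := by
          simpa using (hasDerivAt_id z).const_mul 2
        exact (((h1.const_mul (1 - a)).const_mul _).fun_neg).fun_add ((h2.const_mul N).const_mul ε)
      · have hpow : z ^ (-a) = z ^ (-a - 1) * z := by
          rw [rpow_sub_one hz0.ne']; field_simp
        have hdr := (abs_le.1 (abs_natCast_sub_one_mul_tanh_mul_le hn s (abs_two_mul_div_one_add_sq_le s))).2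
        have hpos : 0 < ε * (2 * N * (1 + a)
            - (2 * (1 + s ^ 2) - 2 * s * (2 * s)) / (1 + s ^ 2) ^ 2
            - (n - 1) * tanh s * (2 * s / (1 + s ^ 2))) :=
          mul_pos hε (by rw [hN2]; linarith [deriv_two_mul_div_one_add_sq_le s])
        refine hpos.trans_eq ?_
        dsimp only
        rw [hpow]
        field_simp
        ring
  have key2 : ∀ Y, 0 < Y → y ≤ Y → m - M / Y ^ (1 - a) * y ^ (1 - a) ≤ u t y := by
    intro Y hY hyY
    have hlim : Tendsto (fun ε : ℝ => m - M / Y ^ (1 - a) * y ^ (1 - a)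
        - ε * (log (1 + t ^ 2) + N * (Y ^ 2 - y ^ 2))) (𝓝[>] 0)
        (𝓝 (m - M / Y ^ (1 - a) * y ^ (1 - a))) := by
      refine Tendsto.mono_left ?_ nhdsWithin_le_nhds
      exact Continuous.tendsto' (by fun_prop) _ _ (by simp)
    refine le_of_tendsto hlim ?_
    filter_upwards [self_mem_nhdsWithin] with ε hε
    exact key Y hY hyY ε hε
  have hlim : Tendsto (fun Y : ℝ => m - M / Y ^ (1 - a) * y ^ (1 - a)) atTop (𝓝 m) := by
    have h1 : Tendsto (fun Y : ℝ => M / Y ^ (1 - a)) atTop (𝓝 0) :=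
      (tendsto_rpow_atTop (by linarith)).const_div_atTop M
    simpa using (h1.mul_const (y ^ (1 - a))).const_sub m
  refine le_of_tendsto hlim ?_
  filter_upwards [eventually_gt_atTop 0, eventually_ge_atTop y] with Y hY hyY
  exact key2 Y hY hyY

lemma hasDerivAt_sub_const_sq (c x : ℝ) :
    HasDerivAt (fun x : ℝ => (x - c) ^ 2) (2 * (x - c)) x := by
  simpa using ((hasDerivAt_id x).sub_const c).fun_pow 2

lemma isStrictSubsolutionAt_gaussian {t₀ y₀ m η κ α s z : ℝ} (hη : 0 < η) (hα : 0 < α)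
    (h : 2 + a / z * (z - y₀) + ((n : ℝ) - 1) * Real.tanh s * (s - t₀) <
      2 * (α * ((s - t₀) ^ 2 + (z - y₀) ^ 2))) :
    IsStrictSubsolutionAt n a
      (fun t y => m + η * (exp (-α * ((t - t₀) ^ 2 + (y - y₀) ^ 2)) - κ)) s z := by
  set e : ℝ → ℝ → ℝ := fun s z => exp (-α * ((s - t₀) ^ 2 + (z - y₀) ^ 2)) with he
  have hes : ∀ s, HasDerivAt (fun s => e s z) (e s z * (-α * (2 * (s - t₀)))) s := fun s =>
    (((hasDerivAt_sub_const_sq t₀ s).add_const ((z - y₀) ^ 2)).const_mul (-α)).exp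
  have hez : ∀ z, HasDerivAt (fun z => e s z) (e s z * (-α * (2 * (z - y₀)))) z := fun z =>
    (((hasDerivAt_sub_const_sq y₀ z).const_add ((s - t₀) ^ 2)).const_mul (-α)).exp
  have hlin : ∀ x c : ℝ, HasDerivAt (fun x => -α * (2 * (x - c))) (-α * 2) x := by
    intro x c
    simpa using (((hasDerivAt_id x).sub_const c).const_mul 2).const_mul (-α)
  refine ⟨fun s => η * (e s z * (-α * (2 * (s - t₀)))),
    fun z => η * (e s z * (-α * (2 * (z - y₀)))), _, _,
    Eventually.of_forall fun s => (((hes s).sub_const _).const_mul η).const_add m,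
    ((hes s).fun_mul (hlin s t₀)).const_mul η,
    Eventually.of_forall fun z => (((hez z).sub_const _).const_mul η).const_add m,
    ((hez z).fun_mul (hlin z y₀)).const_mul η, ?_⟩
  have he0 : 0 < e s z := exp_pos _
  have hpos : 0 < η * e s z * (2 * α) * (2 * (α * ((s - t₀) ^ 2 + (z - y₀) ^ 2)) - 2
      - a / z * (z - y₀) - (n - 1) * tanh s * (s - t₀)) := by
    apply mul_pos (by positivity)
    linarith
  refine hpos.trans_eq ?_
  dsimp only
  ring

lemma abs_le_and_abs_le_of_sq_add_sq_le_sq {x y r : ℝ} (hr : 0 ≤ r) (h : x ^ 2 + y ^ 2 ≤ r ^ 2) :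
    |x| ≤ r ∧ |y| ≤ r :=
  ⟨abs_le_of_sq_le_sq (by linarith [sq_nonneg y]) hr,
    abs_le_of_sq_le_sq (by linarith [sq_nonneg x]) hr⟩

/-- Positivity at a point of the open half-plane spreads to a ball of radius comparable to the
height of the point. -/
lemma lt_of_lt_of_sq_add_sq_lt (hn : 2 ≤ n) (ha : a ∈ Ioo (-1 : ℝ) 1)
    (hcont : ContinuousOn (fun p : ℝ × ℝ => u p.1 p.2) {p : ℝ × ℝ | 0 ≤ p.2})
    (hsm : ContDiffOn ℝ 2 (fun p : ℝ × ℝ => u p.1 p.2) {p : ℝ × ℝ | 0 < p.2})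
    (heq : ∀ t y : ℝ, 0 < y → Ha n a u t y = 0) {m : ℝ}
    (hmu : ∀ t y, 0 ≤ y → m ≤ u t y) {t₀ y₀ : ℝ} (hy₀ : 0 < y₀) (hlt : m < u t₀ y₀)
    {t y : ℝ} (hty : (t - t₀) ^ 2 + (y - y₀) ^ 2 < (y₀ / 2) ^ 2) : m < u t y := by
  obtain ⟨ha1, ha2⟩ := ha
  have hn' : (2 : ℝ) ≤ n := by exact_mod_cast hn
  set η : ℝ := (u t₀ y₀ - m) / 2 with hη
  have hη0 : 0 < η := by rw [hη]; linarith
  obtain ⟨δ, hδ0, hδ⟩ : ∃ δ, 0 < δ ∧ ∀ s z, (s - t₀) ^ 2 + (z - y₀) ^ 2 ≤ δ ^ 2 →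
      m + η ≤ u s z := by
    have hc : ContinuousAt (fun p : ℝ × ℝ => u p.1 p.2) (t₀, y₀) :=
      hcont.continuousAt (mem_of_superset
        (prod_mem_nhds univ_mem (Ici_mem_nhds hy₀)) fun p hp => hp.2)
    have hev := hc.eventually (lt_mem_nhds (show m + η < u t₀ y₀ by rw [hη]; linarith))
    obtain ⟨r, hr, hball⟩ := Metric.eventually_nhds_iff.1 hev
    refine ⟨r / 2, by positivity, fun s z hsz => (hball (y := (s, z)) ?_).le⟩
    obtain ⟨h1, h2⟩ := abs_le_and_abs_le_of_sq_add_sq_le_sq (half_pos hr).le hsz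
    rw [Prod.dist_eq, max_lt_iff, Real.dist_eq, Real.dist_eq]
    exact ⟨h1.trans_lt (half_lt_self hr), h2.trans_lt (half_lt_self hr)⟩
  set C : ℝ := 3 + (n - 1) * (y₀ / 2) with hC
  have hC0 : 0 < C := by
    have : 0 ≤ ((n : ℝ) - 1) * (y₀ / 2) := mul_nonneg (by linarith) (by linarith)
    linarith
  set α : ℝ := C / δ ^ 2 with hα
  have hα0 : 0 < α := by positivity
  have hαδ : α * δ ^ 2 = C := by rw [hα]; field_simp
  set φ : ℝ → ℝ → ℝ := fun t y =>
    m + η * (exp (-α * ((t - t₀) ^ 2 + (y - y₀) ^ 2)) - exp (-α * (y₀ / 2) ^ 2)) with hφ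
  have hle : φ t y ≤ u t y := by
    refine le_of_isStrictSubsolutionAt hcont hsm heq
      (K := {p : ℝ × ℝ | (p.1 - t₀) ^ 2 + (p.2 - y₀) ^ 2 ≤ (y₀ / 2) ^ 2})
      (φ := φ) ?_ ?_ ?_ ?_ (t, y) (by simpa using hty.le)
    · refine (isCompact_Icc.prod isCompact_Icc :
        IsCompact (Icc (t₀ - y₀ / 2) (t₀ + y₀ / 2) ×ˢ Icc (y₀ - y₀ / 2) (y₀ + y₀ / 2))).of_isClosed_subset
        (isClosed_le (by fun_prop) (by fun_prop)) ?_
      rintro ⟨s, z⟩ hsz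
      simp only [mem_ofPred_eq] at hsz
      obtain ⟨h1, h2⟩ := abs_le_and_abs_le_of_sq_add_sq_le_sq (half_pos hy₀).le hsz
      rw [abs_le] at h1 h2
      refine ⟨⟨?_, ?_⟩, ?_, ?_⟩ <;> dsimp only <;> linarith
    · rintro ⟨s, z⟩ hsz
      simp only [mem_ofPred_eq] at hsz ⊢
      have h2 := abs_le.1 (abs_le_and_abs_le_of_sq_add_sq_le_sq (half_pos hy₀).le hsz).2
      linarith
    · exact Continuous.continuousOn (by rw [hφ]; fun_prop)
    · rintro ⟨s, z⟩ hsz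
      simp only [mem_ofPred_eq] at hsz
      dsimp only
      obtain ⟨h1, h2⟩ := abs_le_and_abs_le_of_sq_add_sq_le_sq (half_pos hy₀).le hsz
      have hz : y₀ / 2 ≤ z := by have := (abs_le.1 h2).1; linarith
      have hz0 : 0 < z := by linarith
      rcases le_or_gt ((s - t₀) ^ 2 + (z - y₀) ^ 2) (δ ^ 2) with hin | hout
      · left
        refine le_trans ?_ (hδ s z hin)
        have e1 : exp (-α * ((s - t₀) ^ 2 + (z - y₀) ^ 2)) ≤ 1 :=
          exp_le_one_iff.2 (by nlinarith [sq_nonneg (s - t₀), sq_nonneg (z - y₀)])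
        have e2 := exp_pos (-α * (y₀ / 2) ^ 2)
        rw [hφ]
        nlinarith
      rcases hsz.eq_or_lt with hbdry | hint
      · left
        refine le_trans ?_ (hmu s z hz0.le)
        simp only [hφ, hbdry]
        linarith
      right
      have hnhds : ∀ᶠ p : ℝ × ℝ in 𝓝 (s, z), (p.1 - t₀) ^ 2 + (p.2 - y₀) ^ 2 < (y₀ / 2) ^ 2 :=
        (by fun_prop : Continuous fun p : ℝ × ℝ => (p.1 - t₀) ^ 2 + (p.2 - y₀) ^ 2).continuousAt
          |>.eventually (gt_mem_nhds hint)
      refine ⟨hz0, hnhds.mono fun p hp => hp.le, ?_⟩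
      have hb1 := (abs_le.1 (abs_natCast_sub_one_mul_tanh_mul_le hn s h1)).2
      have hb2 : a / z * (z - y₀) ≤ 1 := by
        refine (le_abs_self _).trans ?_
        rw [abs_mul, abs_div, abs_of_pos hz0, div_mul_eq_mul_div, div_le_one hz0]
        have := abs_lt.2 ⟨ha1, ha2⟩
        nlinarith [abs_nonneg a, abs_nonneg (z - y₀)]
      have hαr : C < α * ((s - t₀) ^ 2 + (z - y₀) ^ 2) := by
        rw [← hαδ]; exact mul_lt_mul_of_pos_left hout hα0
      exact isStrictSubsolutionAt_gaussian hη0 hα0 (by linarith)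
  refine lt_of_lt_of_le ?_ hle
  have : exp (-α * (y₀ / 2) ^ 2) < exp (-α * ((t - t₀) ^ 2 + (y - y₀) ^ 2)) :=
    exp_lt_exp.2 (by nlinarith)
  rw [hφ]
  nlinarith

/-- Strong maximum principle in the open half-plane. -/
lemma lt_of_exists_lt (hn : 2 ≤ n) (ha : a ∈ Ioo (-1 : ℝ) 1)
    (hcont : ContinuousOn (fun p : ℝ × ℝ => u p.1 p.2) {p : ℝ × ℝ | 0 ≤ p.2})
    (hsm : ContDiffOn ℝ 2 (fun p : ℝ × ℝ => u p.1 p.2) {p : ℝ × ℝ | 0 < p.2})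
    (heq : ∀ t y : ℝ, 0 < y → Ha n a u t y = 0) {m : ℝ}
    (hmu : ∀ t y, 0 ≤ y → m ≤ u t y) (hex : ∃ t y, 0 < y ∧ m < u t y)
    (t y : ℝ) (hy : 0 < y) : m < u t y := by
  set U : Set (ℝ × ℝ) := {p | 0 < p.2} with hU
  have hUo : IsOpen U := isOpen_lt continuous_const continuous_snd
  have hUc : IsPreconnected U :=
    ((convex_Ioi (0 : ℝ)).linear_preimage (LinearMap.snd ℝ ℝ ℝ)).isPreconnected
  have hcU := hcont.mono (show U ⊆ {p : ℝ × ℝ | 0 ≤ p.2} from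
    fun p (hp : 0 < p.2) => hp.le)
  set V : Set (ℝ × ℝ) := U ∩ (fun p : ℝ × ℝ => u p.1 p.2) ⁻¹' Ioi m with hV
  have hVo : IsOpen V := hcU.isOpen_inter_preimage hUo isOpen_Ioi
  obtain ⟨t₁, y₁, hy₁, h₁⟩ := hex
  have hsub : U ⊆ V := by
    refine hUc.subset_of_closure_inter_subset hVo ⟨(t₁, y₁), hy₁, hy₁, h₁⟩ ?_
    rintro ⟨s, z⟩ ⟨hcl, hz : 0 < z⟩
    have hW : {p : ℝ × ℝ | (s - p.1) ^ 2 + (z - p.2) ^ 2 < (p.2 / 2) ^ 2} ∈ 𝓝 (s, z) := by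
      refine (isOpen_lt (by fun_prop) (by fun_prop)).mem_nhds ?_
      simp only [mem_ofPred_eq]
      simp [hz]
    obtain ⟨⟨t₀, y₀⟩, hp, hy₀, hlt⟩ := mem_closure_iff_nhds.1 hcl _ hW
    exact ⟨hz, lt_of_lt_of_sq_add_sq_lt hn ha hcont hsm heq hmu hy₀ hlt hp⟩
  exact (hsub (show (t, y) ∈ U from hy)).2

/-- Hopf lemma at the degenerate boundary `y = 0`. -/
lemma pos_of_tendsto_rpow_mul_py (hn : 2 ≤ n) (ha : a ∈ Ioo (-1 : ℝ) 1)
    (hcont : ContinuousOn (fun p : ℝ × ℝ => u p.1 p.2) {p : ℝ × ℝ | 0 ≤ p.2})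
    (hsm : ContDiffOn ℝ 2 (fun p : ℝ × ℝ => u p.1 p.2) {p : ℝ × ℝ | 0 < p.2})
    (heq : ∀ t y : ℝ, 0 < y → Ha n a u t y = 0) {t₀ ℓ : ℝ}
    (hmu : ∀ t y, 0 ≤ y → u t₀ 0 ≤ u t y) (hlt : ∀ t y, 0 < y → u t₀ 0 < u t y)
    (hℓ : Tendsto (fun y : ℝ => y ^ a * py u t₀ y) (𝓝[>] (0 : ℝ)) (𝓝 ℓ)) : 0 < ℓ := by
  obtain ⟨ha1, ha2⟩ := ha
  have hn' : (2 : ℝ) ≤ n := by exact_mod_cast hn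
  set m : ℝ := u t₀ 0 with hm
  set A : ℝ := (n + 1) / (1 + a) with hA
  have hA2 : A * (1 + a) = n + 1 := by
    rw [hA]; exact div_mul_cancel₀ _ (by linarith)
  have hA0 : 0 < A := div_pos (by linarith) (by linarith)
  have hpc : Continuous fun y : ℝ => y ^ (1 - a) :=
    continuous_id.rpow_const fun _ => Or.inr (by linarith)
  obtain ⟨Y, hY0, hY⟩ : ∃ Y, 0 < Y ∧ ∀ y ∈ Icc 0 Y, y ^ (1 - a) + A * y ^ 2 ≤ 1 := by
    have hc : Continuous fun y : ℝ => y ^ (1 - a) + A * y ^ 2 := by fun_prop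
    have h0 : (0 : ℝ) ^ (1 - a) + A * 0 ^ 2 < 1 := by
      rw [zero_rpow (by linarith : 1 - a ≠ 0)]
      norm_num
    have hev := (hc.tendsto 0).eventually (gt_mem_nhds h0)
    obtain ⟨r, hr, hball⟩ := Metric.eventually_nhds_iff.1 hev
    refine ⟨r / 2, by positivity, fun y hy => (hball ?_).le⟩
    rw [Real.dist_eq, sub_zero, abs_of_nonneg hy.1]
    linarith [hy.2]
  obtain ⟨δ, hδ0, hδ⟩ : ∃ δ, 0 < δ ∧ ∀ s ∈ Icc (t₀ - 1) (t₀ + 1), m + δ ≤ u s Y := by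
    have hc : ContinuousOn (fun s => u s Y) (Icc (t₀ - 1) (t₀ + 1)) := fun s _ =>
      (contDiffAt_slices hsm (t := s) hY0).1.continuousAt.continuousWithinAt
    obtain ⟨s₀, _, hs₀⟩ := isCompact_Icc.exists_isMinOn (nonempty_Icc.2 (by linarith)) hc
    refine ⟨u s₀ Y - m, sub_pos.2 (hlt s₀ Y hY0), fun s hs => ?_⟩
    have : u s₀ Y ≤ u s Y := hs₀ hs
    linarith
  have hbar : ∀ y ∈ Icc 0 Y, m + δ * y ^ (1 - a) ≤ u t₀ y := by
    intro y hy
    have hle : m + δ * (y ^ (1 - a) + A * y ^ 2 - (t₀ - t₀) ^ 2) ≤ u t₀ y := by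
      refine le_of_isStrictSubsolutionAt hcont hsm heq
        (K := Icc (t₀ - 1) (t₀ + 1) ×ˢ Icc 0 Y)
        (φ := fun t y => m + δ * (y ^ (1 - a) + A * y ^ 2 - (t - t₀) ^ 2))
        (isCompact_Icc.prod isCompact_Icc) (fun p hp => hp.2.1) ?_ ?_ (t₀, y)
        ⟨⟨by simp, by simp⟩, hy⟩
      · apply Continuous.continuousOn
        have h1 : Continuous fun p : ℝ × ℝ => p.2 ^ (1 - a) := hpc.comp continuous_snd
        fun_prop
      · rintro ⟨s, z⟩ ⟨⟨hs1, hs2⟩, hz1, hz2⟩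
        dsimp only at hs1 hs2 hz1 hz2 ⊢
        have hz1' := hY z ⟨hz1, hz2⟩
        rcases hz1.eq_or_lt with rfl | hz0
        · left
          refine le_trans ?_ (hmu s 0 le_rfl)
          rw [zero_rpow (by linarith : 1 - a ≠ 0)]
          nlinarith [mul_nonneg hδ0.le (sq_nonneg (s - t₀))]
        rcases hz2.eq_or_lt with rfl | hzY
        · left
          refine le_trans ?_ (hδ s ⟨hs1, hs2⟩)
          nlinarith [sq_nonneg (s - t₀)]
        by_cases hs : (s - t₀) ^ 2 = 1
        · left
          refine le_trans ?_ (hmu s z hz1)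
          rw [hs]
          nlinarith
        have hs1' : t₀ - 1 < s := lt_of_le_of_ne hs1 fun h => hs (by rw [← h]; ring)
        have hs2' : s < t₀ + 1 := lt_of_le_of_ne hs2 fun h => hs (by rw [h]; ring)
        right
        refine ⟨hz0, Icc_prod_Icc_mem_nhds hs1' hs2' hz0 hzY,
          fun s => δ * -(2 * (s - t₀)), fun z => δ * ((1 - a) * z ^ (-a) + A * (2 * z)),
          δ * -2, δ * ((1 - a) * (-a * z ^ (-a - 1)) + A * 2), ?_, ?_, ?_, ?_, ?_⟩
        · exact Eventually.of_forall fun s => (((hasDerivAt_sub_const_sq t₀ s).const_sub _).const_mul δ).const_add m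
        · simpa using ((((hasDerivAt_id s).sub_const t₀).const_mul 2).fun_neg).const_mul δ
        · filter_upwards [lt_mem_nhds hz0] with z hz
          have h1 : HasDerivAt (fun z : ℝ => z ^ (1 - a)) ((1 - a) * z ^ (-a)) z := by
            have := hasDerivAt_rpow_const (x := z) (p := 1 - a) (Or.inl hz.ne')
            rwa [show 1 - a - 1 = -a by ring] at this
          have h2 : HasDerivAt (fun z : ℝ => z ^ 2) (2 * z) z := by
            simpa using hasDerivAt_pow 2 z
          exact (((h1.fun_add (h2.const_mul A)).sub_const _).const_mul δ).const_add m
        · have h1 : HasDerivAt (fun z : ℝ => z ^ (-a)) (-a * z ^ (-a - 1)) z :=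
            hasDerivAt_rpow_const (Or.inl hz0.ne')
          have h2 : HasDerivAt (fun z : ℝ => 2 * z) 2 z := by
            simpa using (hasDerivAt_id z).const_mul 2
          exact ((h1.const_mul (1 - a)).fun_add (h2.const_mul A)).const_mul δ
        · have hpow : z ^ (-a) = z ^ (-a - 1) * z := by
            rw [rpow_sub_one hz0.ne']; field_simp
          have hst : |s - t₀| ≤ 1 := abs_le.2 ⟨by linarith, by linarith⟩
          have hdr := (abs_le.1 (abs_natCast_sub_one_mul_tanh_mul_le hn s hst)).2
          have hpos : 0 < δ * 2 * (A * (1 + a) - 1 - (n - 1) * tanh s * (s - t₀)) :=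
            mul_pos (by positivity) (by rw [hA2]; linarith)
          refine hpos.trans_eq ?_
          dsimp only
          rw [hpow]
          field_simp
          ring
    have : 0 ≤ δ * (A * y ^ 2) := by positivity
    nlinarith
  by_contra! hℓ0
  have hev : ∀ᶠ y in 𝓝[>] (0 : ℝ), y ^ a * py u t₀ y < δ / 2 * (1 - a) :=
    hℓ.eventually (gt_mem_nhds (hℓ0.trans_lt (mul_pos (by positivity) (by linarith))))
  obtain ⟨r, hr0 : 0 < r, hr⟩ := mem_nhdsGT_iff_exists_Ioo_subset.1 hev
  set z : ℝ := min (r / 2) Y with hz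
  have hz0 : 0 < z := lt_min (by positivity) hY0
  have hzr : z < r := (min_le_left _ _).trans_lt (by linarith)
  have hc0 : ContinuousOn (fun y => u t₀ y) (Icc 0 z) :=
    hcont.comp (f := fun y : ℝ => (t₀, y)) (by fun_prop) fun y hy => hy.1
  have hanti : AntitoneOn (fun y => u t₀ y - δ / 2 * y ^ (1 - a)) (Icc 0 z) := by
    refine antitoneOn_of_hasDerivWithinAt_nonpos (convex_Icc 0 z)
      (f' := fun y => py u t₀ y - δ / 2 * ((1 - a) * y ^ (-a)))
      (hc0.sub (by fun_prop)) ?_ ?_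
    · intro y hy
      rw [interior_Icc] at hy
      have h1 : HasDerivAt (fun y => u t₀ y) (py u t₀ y) y :=
        ((contDiffAt_slices hsm (t := t₀) hy.1).2.differentiableAt (by simp)).hasDerivAt
      have h2 : HasDerivAt (fun z : ℝ => z ^ (1 - a)) ((1 - a) * y ^ (-a)) y := by
        have := hasDerivAt_rpow_const (x := y) (p := 1 - a) (Or.inl hy.1.ne')
        rwa [show 1 - a - 1 = -a by ring] at this
      exact (h1.fun_sub (h2.const_mul (δ / 2))).hasDerivWithinAt
    · intro y hy
      rw [interior_Icc] at hy
      have h1 : y ^ a * py u t₀ y < δ / 2 * (1 - a) := hr ⟨hy.1, hy.2.trans hzr⟩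
      have h2 : 0 < y ^ (-a) := rpow_pos_of_pos hy.1 _
      have h3 : y ^ (-a) * y ^ a = 1 := by rw [← rpow_add hy.1]; simp
      have h4 : y ^ (-a) * (y ^ a * py u t₀ y) = py u t₀ y := by rw [← mul_assoc, h3, one_mul]
      have h5 := mul_lt_mul_of_pos_left h1 h2
      rw [h4] at h5
      linarith
  have h1 := hanti (left_mem_Icc.2 hz0.le) (right_mem_Icc.2 hz0.le) hz0.le
  have h2 := hbar z ⟨hz0.le, min_le_right _ _⟩
  have h3 : 0 < δ * z ^ (1 - a) := mul_pos hδ0 (rpow_pos_of_pos hz0 _)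
  dsimp only at h1
  rw [zero_rpow (by linarith : 1 - a ≠ 0)] at h1
  linarith

end

/-- Maximum principle on the full half-plane: if `u` is bounded, solves `H_a u = 0` in
`ℝ × (0,∞)` with `-lim_{y→0⁺} y^a ∂_y u(t,y) + d(t) u(t,0) ≥ 0` on `{y = 0}`,
`u(t,0) → 0` as `t → ±∞`, and there is a nonempty set `Sig` with `u(·,0) > 0` on `Σ` and
`d ≥ 0` outside `Sig`, then `u > 0` on `ℝ × [0,∞)`. -/
theorem stmt16 (n : ℕ) (hn : 2 ≤ n) (a : ℝ) (ha : a ∈ Set.Ioo (-1:ℝ) 1)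
    (d : ℝ → ℝ) (hd : ∃ M : ℝ, ∀ t : ℝ, |d t| ≤ M) (u : ℝ → ℝ → ℝ)
    (hb : ∃ M : ℝ, ∀ t y : ℝ, 0 ≤ y → |u t y| ≤ M)
    (hcont : ContinuousOn (fun p : ℝ × ℝ => u p.1 p.2) {p : ℝ × ℝ | 0 ≤ p.2})
    (hsm : ContDiffOn ℝ 2 (fun p : ℝ × ℝ => u p.1 p.2) {p : ℝ × ℝ | 0 < p.2})
    (heq : ∀ t y : ℝ, 0 < y → Ha n a u t y = 0)
    (hbc : ∀ t : ℝ, ∃ ℓ : ℝ,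
      Tendsto (fun y : ℝ => y ^ a * py u t y) (𝓝[>] (0:ℝ)) (𝓝 ℓ) ∧
      0 ≤ -ℓ + d t * u t 0)
    (hlimp : Tendsto (fun t => u t 0) atTop (𝓝 0))
    (hlimm : Tendsto (fun t => u t 0) atBot (𝓝 0))
    (Sig : Set ℝ) (hSne : Sig.Nonempty)
    (hSpos : ∀ t ∈ Sig, 0 < u t 0)
    (hdpos : ∀ t : ℝ, t ∉ Sig → 0 ≤ d t) :
    ∀ t y : ℝ, 0 ≤ y → 0 < u t y := by
  obtain ⟨s₁, hs₁⟩ := hSne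
  have hc0 : Continuous fun t => u t 0 :=
    hcont.comp_continuous (f := fun t : ℝ => (t, (0 : ℝ))) (by fun_prop) fun t => by simp
  have hex : ∀ m ≤ 0, ∃ t y, 0 < y ∧ m < u t y := by
    intro m hm
    have hc : ContinuousWithinAt (fun y => u s₁ y) (Ici 0) 0 :=
      (hcont.comp (f := fun y : ℝ => (s₁, y)) (s := Ici 0) (by fun_prop) fun y hy => hy) 0
        self_mem_Ici
    have hev : ∀ᶠ y in 𝓝[>] (0 : ℝ), 0 < u s₁ y :=
      (hc.mono Ioi_subset_Ici_self).eventually (lt_mem_nhds (hSpos s₁ hs₁))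
    obtain ⟨y, hy, hy0⟩ := (hev.and self_mem_nhdsWithin).exists
    exact ⟨s₁, y, hy0, hm.trans_lt hy⟩
  have hinside : ∀ m ≤ 0, (∀ t, m ≤ u t 0) →
      (∀ t y, 0 ≤ y → m ≤ u t y) ∧ ∀ t y, 0 < y → m < u t y := by
    intro m hm hbd
    have h1 := le_of_le_boundary hn ha hb hcont hsm heq hm hbd
    exact ⟨h1, lt_of_exists_lt hn ha hcont hsm heq h1 (hex m hm)⟩
  -- a nonpositive value at `y = 0` cannot be the minimum there
  have hno : ∀ t₀, u t₀ 0 ≤ 0 → ¬ ∀ t, u t₀ 0 ≤ u t 0 := by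
    intro t₀ ht₀ hmin
    obtain ⟨ℓ, hℓ, hℓd⟩ := hbc t₀
    obtain ⟨h1, h2⟩ := hinside _ ht₀ hmin
    have hpos := pos_of_tendsto_rpow_mul_py hn ha hcont hsm heq h1 h2 hℓ
    have hd0 := hdpos t₀ fun h => (hSpos t₀ h).not_ge ht₀
    nlinarith
  have hnonneg : ∀ t, 0 ≤ u t 0 := by
    intro t
    by_contra! ht
    obtain ⟨t₀, ht₀⟩ := hc0.exists_forall_le' t (by
      rw [cocompact_eq_atBot_atTop, eventually_sup]
      exact ⟨(hlimm.eventually (lt_mem_nhds ht)).mono fun s hs => hs.le,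
        (hlimp.eventually (lt_mem_nhds ht)).mono fun s hs => hs.le⟩)
    exact hno t₀ ((ht₀ t).trans ht.le) ht₀
  intro t y hy
  rcases hy.eq_or_lt with rfl | hy0
  · by_contra! ht
    exact hno t ht fun s => ht.trans (hnonneg s)
  · exact (hinside 0 le_rfl hnonneg).2 t y hy0
end
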